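/- arXiv:1004.0245 — 2 statements merged into one kernel-verified Lean document; each statement's English description precedes it below -/
import Mathlib

section
/- The group U*(2n), endowed with the subspace topology inherited from the space of 2n×2n complex matrices, is path-connected and simply connected. -/
open Matrix

/-- The matrix `J_n` with block form `[[0, Iₙ], [-Iₙ, 0]]`, viewed as a `2n×2n` complex
matrix indexed by `Fin n ⊕ Fin n`. -/
def Jmat (n : ℕ) : Matrix (Fin n ⊕ Fin n) (Fin n ⊕ Fin n) ℂ :=
  Matrix.fromBlocks 0 1 (-1) 0

open ComplexConjugate

theorem isSimplyConnected_setOf_segment_subset {E : Type*} [NormedAddCommGroup E]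
    [NormedSpace ℝ E] {V : Set E} {P : E} (hP : P ∈ V) :
    IsSimplyConnected {x | segment ℝ P x ⊆ V} := by
  have hstar : StarConvex ℝ P {x | segment ℝ P x ⊆ V} :=
    starConvex_iff_segment_subset.2 fun y hy z hz =>
      ((convex_segment P y).segment_subset (left_mem_segment ℝ P y) hz).trans hy
  have := hstar.contractibleSpace ⟨P, by simpa using hP⟩
  exact SimplyConnectedSpace.ofContractible _

theorem exists_path_contDiff_dist_lt {E : Type*} [NormedAddCommGroup E]
    [NormedSpace ℝ E] {x y : E} (p : Path x y) {δ : ℝ} (hδ : 0 < δ) :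
    ∃ (q : ℝ → E) (p' : Path x y), ContDiff ℝ 1 q ∧ (∀ t, p' t = q t) ∧
      ∀ t, dist (p' t) (p t) < δ := by
  have h := Metric.tendsto_atTop.1 (bernsteinApproximation_uniform p.toContinuousMap) δ hδ
  obtain ⟨N, hN⟩ := h
  set n := N + 1
  have hn := hN n (Nat.le_succ N)
  refine ⟨fun t => ∑ k : Fin (n + 1), (bernsteinPolynomial ℝ n k).eval t • p (bernstein.z k),
    ⟨bernsteinApproximation n p.toContinuousMap, ?_, ?_⟩, ?_, fun t => ?_, fun t => ?_⟩
  · simp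
  · simp [n]
  · refine ContDiff.sum fun k _ => ContDiff.smul ?_ contDiff_const
    simpa using (bernsteinPolynomial ℝ n k).contDiff_aeval (𝕜 := ℝ) 1
  · exact bernsteinApproximation.apply n p.toContinuousMap t
  · exact (ContinuousMap.dist_apply_le_dist t).trans_lt hn

theorem isSimplyConnected_of_exists_cone {E : Type*} [NormedAddCommGroup E]
    [NormedSpace ℝ E] {V : Set E} (hV : IsOpen V)
    (hsmul : ∀ c : ℝ, c ≠ 0 → ∀ x ∈ V, c • x ∈ V)
    (hcone : ∀ q : ℝ → E, ContDiff ℝ 1 q → ∃ P, ∀ r t : ℝ, P + r • q t ∈ V) :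
    IsSimplyConnected V := by
  have hstar : ∀ q : ℝ → E, ContDiff ℝ 1 q →
      ∃ P ∈ V, ∀ t, q t ∈ V → q t ∈ {x | segment ℝ P x ⊆ V} := by
    intro q hq
    obtain ⟨P, hP⟩ := hcone q hq
    refine ⟨P, by simpa using hP 0 0, fun t ht => ?_⟩
    rintro _ ⟨a, b, ha, hb, hab, rfl⟩
    rcases eq_or_ne a 0 with rfl | ha0
    · obtain rfl : b = 1 := by linarith
      simpa using ht
    · have := hsmul a ha0 _ (hP (a⁻¹ * b) t)
      rwa [smul_add, smul_smul, mul_inv_cancel_left₀ ha0] at this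
  have hsub : ∀ P : E, {x | segment ℝ P x ⊆ V} ⊆ V :=
    fun P x hx => hx (right_mem_segment ℝ P x)
  rw [isSimplyConnected_iff_exists_homotopy_refl_forall_mem]
  constructor
  · refine isPathConnected_iff.2 ⟨?_, fun x hx y hy => ?_⟩
    · obtain ⟨P, hP, -⟩ := hstar 0 contDiff_const
      exact ⟨P, hP⟩
    · obtain ⟨P, hP, h⟩ := hstar (fun t => AffineMap.lineMap x y t)
        (by simp only [AffineMap.lineMap_apply_module]; fun_prop)
      have hx' := h 0 (by simpa using hx)
      have hy' := h 1 (by simpa using hy)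
      simp only [AffineMap.lineMap_apply_zero, AffineMap.lineMap_apply_one] at hx' hy'
      exact ((isSimplyConnected_setOf_segment_subset hP).isPathConnected.joinedIn
        x hx' y hy').mono (hsub P)
  · intro x p hp
    obtain ⟨δ, hδ, hthick⟩ := (isCompact_range p.continuous).exists_thickening_subset_open hV
      (Set.range_subset_iff.2 hp)
    obtain ⟨q, p', hq, hqp', hdist⟩ := exists_path_contDiff_dist_lt p hδ
    have hball : ∀ t, Metric.ball (p t) δ ⊆ V := fun t =>
      (Metric.ball_subset_thickening (Set.mem_range_self t) δ).trans hthick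
    obtain ⟨P, hP, hcone⟩ := hstar q hq
    obtain ⟨G, hG⟩ := (isSimplyConnected_iff_exists_homotopy_refl_forall_mem.1
      (isSimplyConnected_setOf_segment_subset hP)).2 x p' fun t => by
        rw [hqp']
        exact hcone t (by rw [← hqp']; exact hball t (hdist t))
    let H : p.Homotopy p' :=
      { ContinuousMap.Homotopy.affine p.toContinuousMap p'.toContinuousMap with
        prop' := by
          rintro t s (rfl | rfl) <;> simp }
    have hH : ∀ t, H t ∈ V := by
      rintro ⟨s, t⟩
      refine hball t ((convex_ball (p t) δ).segment_subset (Metric.mem_ball_self hδ)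
        (hdist t) ?_)
      change Path.segment (p t) (p' t) s ∈ _
      rw [← Path.range_segment]
      exact Set.mem_range_self s
    refine ⟨H.trans G, fun t => ?_⟩
    rw [Path.Homotopy.trans, ContinuousMap.HomotopyRel.trans]
    change ContinuousMap.Homotopy.trans _ _ t ∈ V
    rw [ContinuousMap.Homotopy.trans_apply]
    split_ifs
    · exact hH _
    · exact hsub P (hG _)

/-- The complex `2n × 2n` matrix of the quaternionic matrix whose `k`-th column has the entries
`(f k i).1 + (f k i).2 * j`. -/
def quaternionicMatrix {n : ℕ} (f : Fin n → Fin n → ℂ × ℂ) :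
    Matrix (Fin n ⊕ Fin n) (Fin n ⊕ Fin n) ℂ :=
  Matrix.fromBlocks (.of fun i k => (f k i).1) (.of fun i k => (f k i).2)
    (.of fun i k => -conj (f k i).2) (.of fun i k => conj (f k i).1)

theorem continuous_quaternionicMatrix {n : ℕ} :
    Continuous (quaternionicMatrix (n := n)) := by
  unfold quaternionicMatrix
  refine Continuous.matrix_fromBlocks ?_ ?_ ?_ ?_ <;>
  · refine continuous_matrix fun i k => ?_
    simp only [Matrix.of_apply]
    fun_prop

theorem isEmbedding_quaternionicMatrix {n : ℕ} :
    Topology.IsEmbedding (quaternionicMatrix (n := n)) := by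
  refine Function.LeftInverse.isEmbedding
    (f := fun M k i => (M (.inl i) (.inl k), M (.inl i) (.inr k))) (fun f => rfl) ?_
    continuous_quaternionicMatrix
  fun_prop

theorem range_quaternionicMatrix {n : ℕ} : Set.range (quaternionicMatrix (n := n)) =
    {M | M.map (starRingEnd ℂ) * Jmat n = Jmat n * M} := by
  ext M
  obtain ⟨A, B, C, D, rfl⟩ : ∃ A B C D, M = Matrix.fromBlocks A B C D :=
    ⟨_, _, _, _, (Matrix.fromBlocks_toBlocks M).symm⟩
  simp only [Set.mem_range, Set.mem_ofPred_eq, Jmat, Matrix.fromBlocks_map,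
    Matrix.fromBlocks_multiply, Matrix.fromBlocks_inj, quaternionicMatrix]
  constructor
  · rintro ⟨f, rfl, rfl, rfl, rfl⟩
    refine ⟨?_, ?_, ?_, ?_⟩ <;> ext <;> simp
  · rintro ⟨h1, h2, -, -⟩
    refine ⟨fun k i => (A i k, B i k), rfl, rfl, ?_, ?_⟩
    · simp at h1
      ext i k
      simp [← h1]
    · simp at h2
      ext i k
      simp [← h2]

/-- A quaternionic matrix is determined by its columns other than the `j`-th when the `j`-th one
is minus their right linear combination with coefficients `c`. -/
def completeColumns {n : ℕ} (j : Fin n) (g : {k // k ≠ j} → Fin n → ℂ × ℂ)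
    (c : {k // k ≠ j} → ℂ × ℂ) (k i : Fin n) : ℂ × ℂ :=
  if h : k ≠ j then g ⟨k, h⟩ i else
    (-∑ l, ((g l i).1 * (c l).1 + (g l i).2 * (c l).2),
      -∑ l, ((g l i).2 * conj (c l).1 - (g l i).1 * conj (c l).2))

theorem exists_completeColumns_eq {n : ℕ} {f : Fin n → Fin n → ℂ × ℂ}
    (hf : ¬ IsUnit (quaternionicMatrix f)) :
    ∃ j g c, completeColumns j g c = f := by
  rw [Matrix.isUnit_iff_isUnit_det, isUnit_iff_ne_zero, not_not] at hf
  obtain ⟨v, hv0, hv⟩ := Matrix.exists_mulVec_eq_zero_iff.2 hf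
  obtain ⟨x, y, rfl⟩ : ∃ x y, v = Sum.elim x y := ⟨_, _, (Sum.elim_comp_inl_inr v).symm⟩
  obtain ⟨j, hj⟩ : ∃ j, x j ≠ 0 ∨ y j ≠ 0 := by
    by_contra! h
    apply hv0
    ext (i | i) <;> simp [h]
  have h1 : ∀ i, ∑ k, ((f k i).1 * x k + (f k i).2 * y k) = 0 := fun i => by
    simpa [quaternionicMatrix, Matrix.mulVec, dotProduct, Finset.sum_add_distrib] using
      congrFun hv (.inl i)
  have h2 : ∀ i, ∑ k, ((f k i).1 * conj (y k) - (f k i).2 * conj (x k)) = 0 := fun i => by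
    have := congrArg conj (congrFun hv (.inr i))
    simp [quaternionicMatrix, Matrix.mulVec, dotProduct] at this
    rw [Finset.sum_sub_distrib, ← this]
    ring
  set N : ℂ := x j * conj (x j) + y j * conj (y j) with hN
  have hN0 : N ≠ 0 := by
    rw [hN, Complex.mul_conj, Complex.mul_conj, ← Complex.ofReal_add, Complex.ofReal_ne_zero]
    have h1 := Complex.normSq_nonneg (x j)
    have h2 := Complex.normSq_nonneg (y j)
    rcases hj with h | h
    · linarith [Complex.normSq_pos.2 h]
    · linarith [Complex.normSq_pos.2 h]
  have hNc : conj N = N := by simp [hN, mul_comm]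
  refine ⟨j, fun k => f k, fun k => ((x k * conj (x j) + conj (y k) * y j) / N,
    (y k * conj (x j) - conj (x k) * y j) / N), ?_⟩
  ext1 k
  ext1 i
  rcases ne_or_eq k j with h | rfl
  · simp [completeColumns, h]
  have e1 := h1 i
  have e2 := h2 i
  rw [Fintype.sum_eq_add_sum_subtype_ne _ k] at e1 e2
  simp only [completeColumns, ne_eq, not_true_eq_false, dite_false]
  ext1
  · rw [← mul_left_inj' hN0, neg_mul, Finset.sum_mul]
    have : ∀ l : {l // l ≠ k}, ((f l i).1 * ((x l * conj (x k) + conj (y l) * y k) / N) +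
        (f l i).2 * ((y l * conj (x k) - conj (x l) * y k) / N)) * N =
        conj (x k) * ((f l i).1 * x l + (f l i).2 * y l) +
          y k * ((f l i).1 * conj (y l) - (f l i).2 * conj (x l)) := fun l => by
      field_simp
      ring
    rw [Finset.sum_congr rfl fun l _ => this l, Finset.sum_add_distrib, ← Finset.mul_sum,
      ← Finset.mul_sum]
    linear_combination -conj (x k) * e1 - y k * e2 + (f k i).1 * hN
  · rw [← mul_left_inj' hN0, neg_mul, Finset.sum_mul]
    have : ∀ l : {l // l ≠ k},
        ((f l i).2 * conj ((x l * conj (x k) + conj (y l) * y k) / N) -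
          (f l i).1 * conj ((y l * conj (x k) - conj (x l) * y k) / N)) * N =
        conj (y k) * ((f l i).1 * x l + (f l i).2 * y l) -
          x k * ((f l i).1 * conj (y l) - (f l i).2 * conj (x l)) := fun l => by
      simp only [map_div₀, map_add, map_sub, map_mul, Complex.conj_conj, hNc]
      field_simp
      ring
    rw [Finset.sum_congr rfl fun l _ => this l, Finset.sum_sub_distrib, ← Finset.mul_sum,
      ← Finset.mul_sum]
    linear_combination -conj (y k) * e1 + x k * e2 + (f k i).2 * hN

theorem contDiff_completeColumns {n : ℕ} (j : Fin n) :
    ContDiff ℝ 1 fun z : ({k // k ≠ j} → Fin n → ℂ × ℂ) × ({k // k ≠ j} → ℂ × ℂ) =>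
      completeColumns j z.1 z.2 := by
  have hconj : ContDiff ℝ 1 (conj : ℂ → ℂ) := Complex.conjCLE.contDiff
  refine contDiff_pi.2 fun k => contDiff_pi.2 fun i => ?_
  unfold completeColumns
  split_ifs with h
  · fun_prop
  · fun_prop

theorem exists_isUnit_add_smul {n : ℕ} (hn : 1 ≤ n) (q : ℝ → Fin n → Fin n → ℂ × ℂ) (hq : ContDiff ℝ 1 q) :
    ∃ P, ∀ r t : ℝ, IsUnit (quaternionicMatrix (P + r • q t)) := by
  let Φ (j : Fin n) (z : (({k // k ≠ j} → Fin n → ℂ × ℂ) × ({k // k ≠ j} → ℂ × ℂ)) × ℝ × ℝ) :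
      Fin n → Fin n → ℂ × ℂ := completeColumns j z.1.1 z.1.2 - z.2.1 • q z.2.2
  have hΦ : ∀ j, ContDiff ℝ 1 (Φ j) := fun j =>
    ((contDiff_completeColumns j).comp contDiff_fst).sub
      (contDiff_snd.fst.smul (hq.comp contDiff_snd.snd))
  have hdim : dimH (⋃ j, Set.range (Φ j)) < Module.finrank ℝ (Fin n → Fin n → ℂ × ℂ) := by
    rw [dimH_iUnion]
    obtain ⟨m, rfl⟩ : ∃ m, n = m + 1 := ⟨n - 1, by omega⟩
    have hcard : ∀ j : Fin (m + 1), Module.finrank ℝ ((({k // k ≠ j} → Fin (m + 1) → ℂ × ℂ) ×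
        ({k // k ≠ j} → ℂ × ℂ)) × ℝ × ℝ) = m * ((m + 1) * 4) + m * 4 + 2 := fun j => by
      simp [Module.finrank_pi_fintype, Complex.finrank_real_complex, Fintype.card_subtype_compl]
    have htotal : Module.finrank ℝ (Fin (m + 1) → Fin (m + 1) → ℂ × ℂ) =
        (m + 1) * ((m + 1) * 4) := by
      simp [Module.finrank_pi_fintype, Complex.finrank_real_complex]
    refine (iSup_le fun j => ((hΦ j).dimH_range_le.trans_eq (by rw [hcard j]))).trans_lt
      (b := ((m * ((m + 1) * 4) + m * 4 + 2 : ℕ) : ENNReal)) ?_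
    rw [htotal, Nat.cast_lt]
    linarith
  obtain ⟨P, hP⟩ := (dense_compl_of_dimH_lt_finrank hdim).nonempty
  refine ⟨P, fun r t => ?_⟩
  by_contra h
  obtain ⟨j, g, c, hgc⟩ := exists_completeColumns_eq h
  exact hP (Set.mem_iUnion.2 ⟨j, ((g, c), r, t), by simp [Φ, hgc]⟩)

theorem isSimplyConnected_isUnit_quaternionicMatrix {n : ℕ} (hn : 1 ≤ n) :
    IsSimplyConnected {f : Fin n → Fin n → ℂ × ℂ | IsUnit (quaternionicMatrix f)} := by
  refine isSimplyConnected_of_exists_cone ?_ (fun c hc f hf => ?_)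
    (exists_isUnit_add_smul hn)
  · simp only [Matrix.isUnit_iff_isUnit_det, isUnit_iff_ne_zero]
    exact isOpen_ne.preimage continuous_quaternionicMatrix.matrix_det
  · have : quaternionicMatrix (c • f) = c • quaternionicMatrix f := by
      ext (i | i) (k | k) <;> simp [quaternionicMatrix]
    rw [Set.mem_ofPred_eq, this]
    exact hf.smul (Units.mk0 c hc)

/-- The group `U*(2n) = {M ∈ GL(2n,ℂ) : conj(M)·Jₙ = Jₙ·M}`, with the subspace topology
inherited from the `2n×2n` complex matrices, is path-connected and simply connected. -/
theorem stmt12 (n : ℕ) (hn : 1 ≤ n) :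
    PathConnectedSpace
      {M : Matrix (Fin n ⊕ Fin n) (Fin n ⊕ Fin n) ℂ //
        IsUnit M ∧ M.map (starRingEnd ℂ) * Jmat n = Jmat n * M} ∧
    SimplyConnectedSpace
      {M : Matrix (Fin n ⊕ Fin n) (Fin n ⊕ Fin n) ℂ //
        IsUnit M ∧ M.map (starRingEnd ℂ) * Jmat n = Jmat n * M} := by
  have himage : quaternionicMatrix '' {f : Fin n → Fin n → ℂ × ℂ | IsUnit (quaternionicMatrix f)} =
      {M | IsUnit M ∧ M.map (starRingEnd ℂ) * Jmat n = Jmat n * M} := by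
    change quaternionicMatrix '' (quaternionicMatrix ⁻¹' {M | IsUnit M}) = _
    rw [Set.image_preimage_eq_inter_range, range_quaternionicMatrix]
    rfl
  have h := isEmbedding_quaternionicMatrix.isSimplyConnected_image.2
    (isSimplyConnected_isUnit_quaternionicMatrix hn)
  rw [himage] at h
  have := h.simplyConnectedSpace
  exact ⟨inferInstanceAs (PathConnectedSpace
    {M | IsUnit M ∧ M.map (starRingEnd ℂ) * Jmat n = Jmat n * M}), this⟩
end

section
/- Let (V, Ω) be a complex symplectic vector space and let U, U'' ⊆ V be isotropic subspaces with U ≠ 0 such that the pairing U × U'' → ℂ, (u, w) ↦ Ω(u, w), is nondegenerate. Then there exists a nonzero Ω-skew-symmetric endomorphism A of V such that A(U) ⊆ U'', A vanishes on U'', and A vanishes on the Ω-orthogonal complement (U + U'')^⊥. -/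
/-- Let `(V, Ω)` be a complex symplectic vector space and `U, U'' ⊆ V` isotropic subspaces
with `U ≠ 0` such that the pairing `U × U'' → ℂ`, `(u,w) ↦ Ω(u,w)`, is nondegenerate.
Then there is a nonzero `Ω`-skew-symmetric endomorphism `A` of `V` with `A(U) ⊆ U''`,
`A` vanishing on `U''`, and `A` vanishing on the `Ω`-orthogonal complement `(U + U'')^⊥`. -/
theorem stmt14 (V : Type*) [AddCommGroup V] [Module ℂ V] [FiniteDimensional ℂ V]
    (Ω : V →ₗ[ℂ] V →ₗ[ℂ] ℂ)
    (halt : ∀ v, Ω v v = 0)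
    (hnd : ∀ v, (∀ w, Ω v w = 0) → v = 0)
    (U U'' : Submodule ℂ V)
    (hUiso : ∀ u ∈ U, ∀ u' ∈ U, Ω u u' = 0)
    (hU''iso : ∀ w ∈ U'', ∀ w' ∈ U'', Ω w w' = 0)
    (hUne : U ≠ ⊥)
    (hpair₁ : ∀ u ∈ U, (∀ w ∈ U'', Ω u w = 0) → u = 0)
    (hpair₂ : ∀ w ∈ U'', (∀ u ∈ U, Ω u w = 0) → w = 0) :
    ∃ A : Module.End ℂ V, A ≠ 0 ∧
      (∀ u v, Ω (A u) v = -Ω u (A v)) ∧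
      (∀ u ∈ U, A u ∈ U'') ∧
      (∀ w ∈ U'', A w = 0) ∧
      (∀ v, (∀ x ∈ (U ⊔ U'' : Submodule ℂ V), Ω x v = 0) → A v = 0) := by
  obtain ⟨u, hu, hu0⟩ := U.exists_mem_ne_zero_of_ne_bot hUne
  obtain ⟨w, hw, huw⟩ : ∃ w ∈ U'', Ω u w ≠ 0 := by
    by_contra! h
    exact hu0 (hpair₁ u hu h)
  have hskew : ∀ x y, Ω x y = -Ω y x := fun x y => (LinearMap.IsAlt.neg halt y x).symm
  have hw0 : w ≠ 0 := by
    rintro rfl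
    simp at huw
  refine ⟨(Ω w).smulRight w, fun hA => ?_, fun x y => ?_, fun x _ => ?_, fun x hx => ?_,
    fun v hv => ?_⟩
  · have h := LinearMap.congr_fun hA u
    rw [LinearMap.smulRight_apply, LinearMap.zero_apply, smul_eq_zero, hskew, neg_eq_zero] at h
    exact h.elim huw hw0
  · simp only [LinearMap.smulRight_apply, map_smul, LinearMap.smul_apply, smul_eq_mul]
    rw [hskew x w]
    ring
  · exact U''.smul_mem _ hw
  · simp [hU''iso w hw x hx]
  · simp [hv w (Submodule.mem_sup_right hw)]
end
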